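/- arXiv:2204.00755 — 2 statements merged into one kernel-verified Lean document; each statement's English description precedes it below -/
import Mathlib

section
/- In a POMDP, if a belief b is winning for a reach-avoid specification φ = ⟨REACH, AVOID⟩ (i.e., there exists an observation-based policy such that, starting from belief b, with probability 1 the induced path reaches some state in REACH while never visiting a state in AVOID), then every belief b' with supp(b') = supp(b) is also winning for φ. -/
/-!
STATEMENT 0: In a POMDP, if a belief `b` is winning for a reach-avoid specification
`φ = ⟨REACH, AVOID⟩` (i.e., there exists an observation-based policy such that, starting
from belief `b`, with probability 1 the induced path reaches some state in `REACH` while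
never visiting a state in `AVOID`), then every belief `b'` with `supp(b') = supp(b)` is
also winning for `φ`.

"With probability 1 the induced path reaches REACH while never visiting AVOID" is
formalized exactly through finite horizons: the event is the intersection of
"never visit AVOID" and "eventually reach REACH"; an intersection of two events has
probability 1 iff both do; "never visit AVOID" has probability 1 iff every
finite-horizon avoidance event has probability 1 (continuity from above), and the
probability of "eventually reach REACH" is the supremum over horizons `n` of the
probability of reaching within `n` steps (continuity from below).  Finite-horizon
probabilities are finite sums computed recursively.
-/

open scoped ENNReal

/-- A POMDP with state space `S`, actions `A`, observations `Z`:
a transition function assigning to each state-action pair a distribution over states,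
and an observation function. -/
structure POMDP (S A Z : Type*) where
  P : S → A → PMF S
  O : S → Z

/-- An observation-based (randomized) policy: maps an observation-action history together
with the current observation to a distribution over actions. -/
abbrev ObsPolicy (A Z : Type*) := List (Z × A) → Z → PMF A

variable {S A Z : Type*} [Fintype S] [Fintype A]

open Classical in
/-- `M.avoidProb AVOID π n h s` is the probability, under observation-based policy `π`
run with accumulated history `h`, that the path starting in state `s` visits no state of
`AVOID` during the next `n` steps (including the current state `s`). -/
noncomputable def POMDP.avoidProb (M : POMDP S A Z) (AVOID : Set S) (π : ObsPolicy A Z) :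
    ℕ → List (Z × A) → S → ℝ≥0∞
  | 0, _, s => if s ∈ AVOID then 0 else 1
  | n + 1, h, s =>
    if s ∈ AVOID then 0
    else ∑ a : A, π h (M.O s) a *
      ∑ s' : S, M.P s a s' * M.avoidProb AVOID π n (h ++ [(M.O s, a)]) s'

open Classical in
/-- `M.reachProb REACH π n h s` is the probability, under observation-based policy `π`
run with accumulated history `h`, that the path starting in state `s` visits some state
of `REACH` within the next `n` steps (including the current state `s`). -/
noncomputable def POMDP.reachProb (M : POMDP S A Z) (REACH : Set S) (π : ObsPolicy A Z) :
    ℕ → List (Z × A) → S → ℝ≥0∞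
  | 0, _, s => if s ∈ REACH then 1 else 0
  | n + 1, h, s =>
    if s ∈ REACH then 1
    else ∑ a : A, π h (M.O s) a *
      ∑ s' : S, M.P s a s' * M.reachProb REACH π n (h ++ [(M.O s, a)]) s'

/-- A belief `b` is winning for the reach-avoid specification `⟨REACH, AVOID⟩` if there is
an observation-based policy under which, starting from a state sampled according to `b`,
with probability 1 the induced path reaches some state in `REACH` while never visiting a
state in `AVOID`; equivalently (and exactly), every finite-horizon avoidance probability
equals 1 and the finite-horizon reach probabilities converge to 1. -/
def POMDP.WinningBelief (M : POMDP S A Z) (REACH AVOID : Set S) (b : PMF S) : Prop :=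
  ∃ π : ObsPolicy A Z,
    (∀ n : ℕ, ∑ s : S, b s * M.avoidProb AVOID π n [] s = 1) ∧
    (⨆ n : ℕ, ∑ s : S, b s * M.reachProb REACH π n [] s) = 1

/-- The total mass of a probability mass function on a finite type is one. -/
theorem PMF.sum_coe_fintype {α : Type*} [Fintype α] (p : PMF α) : ∑ x, p x = 1 := by
  simpa only [tsum_fintype] using p.tsum_coe

/-- The average of a function bounded by one is bounded by one. -/
theorem PMF.sum_mul_le_one {α : Type*} [Fintype α] (p : PMF α) {f : α → ℝ≥0∞}
    (hf : ∀ x, f x ≤ 1) : ∑ x, p x * f x ≤ 1 :=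
  calc ∑ x, p x * f x ≤ ∑ x, p x := Finset.sum_le_sum fun x _ => mul_le_of_le_one_right' (hf x)
    _ = 1 := p.sum_coe_fintype

/-- A function bounded by one has average one iff it equals one on the support. -/
theorem PMF.sum_mul_eq_one_iff {α : Type*} [Fintype α] (p : PMF α) {f : α → ℝ≥0∞}
    (hf : ∀ x, f x ≤ 1) : ∑ x, p x * f x = 1 ↔ ∀ x ∈ p.support, f x = 1 := by
  have hle : ∀ x, p x * f x ≤ p x := fun x => mul_le_of_le_one_right' (hf x)
  constructor
  · intro h x hx
    by_contra hne
    have hlt : p x * f x < p x := by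
      simpa using ENNReal.mul_lt_mul_right ((p.mem_support_iff x).1 hx) (p.apply_ne_top x)
        (lt_of_le_of_ne (hf x) hne)
    have hsum : ∑' y, p y * f y < ∑' y, p y :=
      ENNReal.tsum_lt_tsum (by simp [tsum_fintype, h]) hle hlt
    rw [tsum_fintype, h, p.tsum_coe] at hsum
    exact hsum.false
  · intro h
    rw [← p.sum_coe_fintype]
    refine Finset.sum_congr rfl fun x _ => ?_
    by_cases hx : x ∈ p.support
    · rw [h x hx, mul_one]
    · rw [(p.apply_eq_zero_iff x).2 hx, zero_mul]

namespace POMDP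

theorem avoidProb_le_one (M : POMDP S A Z) (AVOID : Set S) (π : ObsPolicy A Z) (n : ℕ)
    (h : List (Z × A)) (s : S) : M.avoidProb AVOID π n h s ≤ 1 := by
  induction n generalizing h s with
  | zero => rw [avoidProb]; split_ifs <;> simp
  | succ n ih =>
    rw [avoidProb]
    split_ifs
    · exact zero_le
    · exact PMF.sum_mul_le_one _ fun a => PMF.sum_mul_le_one _ fun s' => ih _ s'

theorem reachProb_le_one (M : POMDP S A Z) (REACH : Set S) (π : ObsPolicy A Z) (n : ℕ)
    (h : List (Z × A)) (s : S) : M.reachProb REACH π n h s ≤ 1 := by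
  induction n generalizing h s with
  | zero => rw [reachProb]; split_ifs <;> simp
  | succ n ih =>
    rw [reachProb]
    split_ifs
    · exact le_rfl
    · exact PMF.sum_mul_le_one _ fun a => PMF.sum_mul_le_one _ fun s' => ih _ s'

theorem reachProb_le_succ (M : POMDP S A Z) (REACH : Set S) (π : ObsPolicy A Z) (n : ℕ)
    (h : List (Z × A)) (s : S) :
    M.reachProb REACH π n h s ≤ M.reachProb REACH π (n + 1) h s := by
  induction n generalizing h s with
  | zero => rw [reachProb, reachProb]; split_ifs <;> simp
  | succ n ih =>
    rw [reachProb, reachProb]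
    split_ifs
    · exact le_rfl
    · gcongr
      exact ih _ _

theorem monotone_reachProb (M : POMDP S A Z) (REACH : Set S) (π : ObsPolicy A Z)
    (h : List (Z × A)) (s : S) : Monotone fun n => M.reachProb REACH π n h s :=
  monotone_nat_of_le_succ fun n => M.reachProb_le_succ REACH π n h s

/-- The limiting reach probability from a belief is the average of the limiting reach
probabilities from its states. -/
theorem iSup_sum_mul_reachProb (M : POMDP S A Z) (REACH : Set S) (π : ObsPolicy A Z)
    (h : List (Z × A)) (b : PMF S) :
    ⨆ n, ∑ s, b s * M.reachProb REACH π n h s =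
      ∑ s, b s * ⨆ n, M.reachProb REACH π n h s := by
  simp_rw [ENNReal.mul_iSup]
  exact (ENNReal.finsetSum_iSup_of_monotone fun s _ _ hmn =>
    mul_le_mul_right (M.monotone_reachProb REACH π h s hmn) (b s)).symm

/-- A belief is winning iff a single policy is almost surely winning from every state of its
support. -/
theorem winningBelief_iff_forall_mem_support (M : POMDP S A Z) (REACH AVOID : Set S)
    (b : PMF S) :
    M.WinningBelief REACH AVOID b ↔ ∃ π : ObsPolicy A Z,
      (∀ n, ∀ s ∈ b.support, M.avoidProb AVOID π n [] s = 1) ∧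
      ∀ s ∈ b.support, ⨆ n, M.reachProb REACH π n [] s = 1 := by
  refine exists_congr fun π => and_congr (forall_congr' fun n => ?_) ?_
  · exact b.sum_mul_eq_one_iff (M.avoidProb_le_one AVOID π n [])
  · rw [iSup_sum_mul_reachProb]
    exact b.sum_mul_eq_one_iff fun s => iSup_le fun n => M.reachProb_le_one REACH π n [] s

end POMDP

/-- If a belief `b` is winning for the reach-avoid specification
`⟨REACH, AVOID⟩`, then every belief `b'` with the same support is winning as well. -/
theorem winning_of_eq_support (M : POMDP S A Z) (REACH AVOID : Set S) (b b' : PMF S)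
    (hsupp : b'.support = b.support) (hb : M.WinningBelief REACH AVOID b) :
    M.WinningBelief REACH AVOID b' := by
  rw [POMDP.winningBelief_iff_forall_mem_support] at hb ⊢
  rwa [hsupp]
end

section
/- Let φ = ⟨AVOID⟩ be an avoid specification for a POMDP M and let ν be a φ-shield for M. Then every policy on belief supports that is admissible for ν is winning for φ: starting from any winning belief support, with probability 1 the induced path never visits a state in AVOID. -/
/-!
STATEMENT 1: Let `φ = ⟨AVOID⟩` be an avoid specification for a POMDP `M` and let `ν` be a
`φ`-shield for `M`.  Then every policy on belief supports that is admissible for `ν` is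
winning for `φ`: starting from any winning belief support, with probability 1 the induced
path never visits a state in `AVOID`.

"With probability 1 the path never visits AVOID" is formalized exactly through finite
horizons: the event "never visit AVOID" has probability 1 iff, for every horizon `n`, the
probability of avoiding `AVOID` for `n` steps equals 1 (continuity from above).
Finite-horizon probabilities are finite sums computed recursively.
-/

open scoped ENNReal

variable {S A Z : Type*} [Fintype S] [Fintype A]

/-- The graph-based belief-support update `(B' | B, a, z)`:
`{s' ∈ S : O(s') = z and P(s' | s, a) > 0 for some s ∈ B}`. -/
def POMDP.supUpdate (M : POMDP S A Z) (B : Set S) (a : A) (z : Z) : Set S :=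
  {s' | M.O s' = z ∧ ∃ s ∈ B, 0 < M.P s a s'}

/-- A belief `b` is winning for the avoid specification `⟨AVOID⟩` if there is an
observation-based policy under which, with probability 1, the induced path never visits a
state in `AVOID` (equivalently: all finite-horizon avoidance probabilities are 1). -/
def POMDP.WinningBeliefAvoid (M : POMDP S A Z) (AVOID : Set S) (b : PMF S) : Prop :=
  ∃ π : ObsPolicy A Z, ∀ n : ℕ, ∑ s : S, b s * M.avoidProb AVOID π n [] s = 1

/-- A belief support `B` is winning if some belief with support `B` is winning. -/
def POMDP.WinningSupportAvoid (M : POMDP S A Z) (AVOID : Set S) (B : Set S) : Prop :=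
  ∃ b : PMF S, b.support = B ∧ M.WinningBeliefAvoid AVOID b

/-- A permissive policy `ν` is a `⟨AVOID⟩`-shield if for every winning belief support `B`,
every allowed action `a ∈ ν(B)` and every observation `z`, the updated belief support
`(B' | B, a, z)`, whenever nonempty, is winning again. -/
def POMDP.IsShieldAvoid (M : POMDP S A Z) (AVOID : Set S) (ν : Set S → Set A) : Prop :=
  ∀ B : Set S, M.WinningSupportAvoid AVOID B → ∀ a ∈ ν B, ∀ z : Z,
    (M.supUpdate B a z).Nonempty → M.WinningSupportAvoid AVOID (M.supUpdate B a z)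

open Classical in
/-- Probability that the path induced by the deterministic belief-support policy `π`,
started in state `s` with current belief support `B`, visits no state of `AVOID` during
the next `n` steps (incl. `s`).  At each step the action `π B` is taken and the belief
support is updated according to the obtained observation. -/
noncomputable def POMDP.avoidProbBS (M : POMDP S A Z) (AVOID : Set S) (π : Set S → A) :
    ℕ → Set S → S → ℝ≥0∞
  | 0, _, s => if s ∈ AVOID then 0 else 1
  | n + 1, B, s =>
    if s ∈ AVOID then 0
    else ∑ s' : S, M.P s (π B) s' *
      M.avoidProbBS AVOID π n (M.supUpdate B (π B) (M.O s')) s'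

/-- A probability mass function on a finite type sums to one. -/
theorem PMF.sum_coe_fintype_s1 (b : PMF S) : ∑ s : S, b s = 1 := by
  rw [← tsum_fintype (L := .unconditional S)]
  exact b.tsum_coe

/-- A function equal to one on the support of a probability mass function has mean one. -/
theorem PMF.sum_mul_eq_one_of_eq_one_on_support (b : PMF S) (f : S → ℝ≥0∞)
    (hf : ∀ s ∈ b.support, f s = 1) : ∑ s : S, b s * f s = 1 := by
  rw [← b.sum_coe_fintype_s1]
  refine Finset.sum_congr rfl fun s _ => ?_
  by_cases hs : b s = 0
  · simp [hs]
  · rw [hf s ((b.mem_support_iff s).2 hs), mul_one]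

/-- A winning belief support contains no state of `AVOID`. -/
theorem POMDP.WinningSupportAvoid.notMem_avoid {M : POMDP S A Z} {AVOID B : Set S}
    (hB : M.WinningSupportAvoid AVOID B) {s : S} (hs : s ∈ B) : s ∉ AVOID := by
  classical
  obtain ⟨b, rfl, σ, hσ⟩ := hB
  intro hsA
  have hle : b s + ∑ t : S, b t * M.avoidProb AVOID σ 0 [] t ≤ ∑ t : S, b t := by
    rw [← Finset.add_sum_erase _ _ (Finset.mem_univ s),
      ← Finset.add_sum_erase _ (fun t => b t) (Finset.mem_univ s)]
    simp only [POMDP.avoidProb, if_pos hsA, mul_zero, zero_add]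
    gcongr with t
    split_ifs <;> simp
  rw [hσ 0, b.sum_coe_fintype_s1] at hle
  have hzero : b s = 0 := by
    have h : b s + 1 ≤ 0 + 1 := by rwa [zero_add]
    exact le_antisymm ((ENNReal.add_le_add_iff_right ENNReal.one_ne_top).1 h) zero_le
  exact (b.mem_support_iff s).1 hs hzero

/-- From every state of a winning belief support, a policy admissible for a shield avoids
`AVOID` with probability one up to any horizon. -/
theorem POMDP.IsShieldAvoid.avoidProbBS_eq_one {M : POMDP S A Z} {AVOID : Set S}
    {ν : Set S → Set A} (hshield : M.IsShieldAvoid AVOID ν)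
    {π : Set S → A} (hadm : ∀ B : Set S, π B ∈ ν B) (n : ℕ) {B : Set S}
    (hB : M.WinningSupportAvoid AVOID B) {s : S} (hs : s ∈ B) :
    M.avoidProbBS AVOID π n B s = 1 := by
  induction n generalizing B s with
  | zero => simp [POMDP.avoidProbBS, hB.notMem_avoid hs]
  | succ n ih =>
    rw [POMDP.avoidProbBS, if_neg (hB.notMem_avoid hs)]
    refine PMF.sum_mul_eq_one_of_eq_one_on_support _ _ fun s' hs' => ?_
    have hmem : s' ∈ M.supUpdate B (π B) (M.O s') :=
      ⟨rfl, s, hs, pos_iff_ne_zero.2 ((PMF.mem_support_iff _ _).1 hs')⟩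
    exact ih (hshield B hB (π B) (hadm B) (M.O s') ⟨s', hmem⟩) hmem

/-- If `ν` is a `⟨AVOID⟩`-shield for `M`, then every belief-support policy
`π` admissible for `ν` (i.e. `π B ∈ ν B` for all `B`) is winning for `⟨AVOID⟩`: starting
from any winning belief support `B` (i.e. from any belief `b` with support `B`), with
probability 1 the induced path never visits a state in `AVOID`. -/
theorem avoid_shield_admissible_winning (M : POMDP S A Z) (AVOID : Set S)
    (ν : Set S → Set A) (hshield : M.IsShieldAvoid AVOID ν)
    (π : Set S → A) (hadm : ∀ B : Set S, π B ∈ ν B) :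
    ∀ B : Set S, M.WinningSupportAvoid AVOID B →
      ∀ b : PMF S, b.support = B →
        ∀ n : ℕ, ∑ s : S, b s * M.avoidProbBS AVOID π n B s = 1 := by
  rintro B hB b rfl n
  exact b.sum_mul_eq_one_of_eq_one_on_support _ fun s hs =>
    hshield.avoidProbBS_eq_one hadm n hB hs
end
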